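/- The function V satisfies the boundary conditions of the Hamilton–Jacobi–Bellman problem: for each fixed y > 0, V(x,y) → 0 as x → 0⁺ and V(x,y) → 1 − exp(−2y) as x → ∞; and for each fixed x > 0, V(x,y) → 0 as y → 0⁺ and V(x,y) → 1 − exp(−2x) as y → ∞. -/

import Mathlib

open MeasureTheory Set Filter

noncomputable def Phi (z : ℝ) : ℝ :=
  (Real.sqrt (2 * Real.pi))⁻¹ * ∫ u in Set.Iio z, Real.exp (-(u ^ 2) / 2)

open Classical in
/-- The explicit value function for `ρ = 1`, `δ = 0`, `μ̄ = 1`. -/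
noncomputable def Vfun (x y : ℝ) : ℝ :=
  if x = y then 1 - Real.exp (-x)
  else
    Phi (max x y / Real.sqrt |y - x|)
      - Real.exp (-2 * min x y) * Phi ((|y - x| - min x y) / Real.sqrt |y - x|)
      - Real.exp (-(x + y) / 2) * (2 * Phi (min x y / Real.sqrt |y - x|) - 1)

/-- Partial derivative of `Vfun` in the first variable. -/
noncomputable def Vx (x y : ℝ) : ℝ := deriv (fun x' => Vfun x' y) x

/-- Partial derivative of `Vfun` in the second variable. -/
noncomputable def Vy (x y : ℝ) : ℝ := deriv (fun y' => Vfun x y') y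

/-- Second partial derivative of `Vfun` in the first variable. -/
noncomputable def Vxx (x y : ℝ) : ℝ := deriv (fun x' => Vx x' y) x

/-- Second partial derivative of `Vfun` in the second variable. -/
noncomputable def Vyy (x y : ℝ) : ℝ := deriv (fun y' => Vy x y') y

/-- Mixed second partial derivative of `Vfun`. -/
noncomputable def Vxy (x y : ℝ) : ℝ := deriv (fun y' => Vx x y') y


lemma gauss_int : Integrable (fun u : ℝ => Real.exp (-(u ^ 2) / 2)) := by
  have h := integrable_exp_neg_mul_sq (b := 1 / 2) (by norm_num)
  refine h.congr (Eventually.of_forall fun u => ?_)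
  simp only
  congr 1
  ring

lemma gauss_Ioi : ∫ u in Set.Ioi (0 : ℝ), Real.exp (-(u ^ 2) / 2)
    = Real.sqrt (2 * Real.pi) / 2 := by
  have h := integral_gaussian_Ioi (1 / 2)
  rw [show Real.pi / (1 / 2) = 2 * Real.pi by ring] at h
  rw [← h]
  congr 1
  ext u
  congr 1
  ring

lemma gauss_Iic : ∫ u in Set.Iic (0 : ℝ), Real.exp (-(u ^ 2) / 2)
    = Real.sqrt (2 * Real.pi) / 2 := by
  have h := integral_comp_neg_Ioi (0 : ℝ) (fun u : ℝ => Real.exp (-(u ^ 2) / 2))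
  simp only [neg_sq, neg_zero] at h
  rw [← h, gauss_Ioi]

lemma sqrt_two_pi_pos : 0 < Real.sqrt (2 * Real.pi) :=
  Real.sqrt_pos.mpr (by positivity)

lemma Phi_eq (z : ℝ) : Phi z = 1 / 2 + (Real.sqrt (2 * Real.pi))⁻¹ *
    ∫ u in (0 : ℝ)..z, Real.exp (-(u ^ 2) / 2) := by
  have h := intervalIntegral.integral_Iic_sub_Iic (a := 0) (b := z)
    gauss_int.integrableOn gauss_int.integrableOn
  rw [gauss_Iic] at h
  have hp := sqrt_two_pi_pos
  rw [Phi, ← integral_Iic_eq_integral_Iio, ← h]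
  field_simp
  ring

lemma Phi_zero : Phi 0 = 1 / 2 := by simp [Phi_eq]

lemma Phi_cont : Continuous Phi := by
  have : Phi = fun z => 1 / 2 + (Real.sqrt (2 * Real.pi))⁻¹ *
    ∫ u in (0 : ℝ)..z, Real.exp (-(u ^ 2) / 2) := funext Phi_eq
  rw [this]
  exact continuous_const.add (continuous_const.mul
    (intervalIntegral.continuous_primitive (fun a b => gauss_int.intervalIntegrable) 0))

lemma Phi_top : Tendsto Phi atTop (nhds 1) := by
  have : Phi = fun z => 1 / 2 + (Real.sqrt (2 * Real.pi))⁻¹ *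
    ∫ u in (0 : ℝ)..z, Real.exp (-(u ^ 2) / 2) := funext Phi_eq
  rw [this]
  have h := intervalIntegral_tendsto_integral_Ioi (0 : ℝ) (gauss_int.integrableOn) tendsto_id
  rw [gauss_Ioi] at h
  have h2 := (h.const_mul (Real.sqrt (2 * Real.pi))⁻¹).const_add (1 / 2)
  have hp := sqrt_two_pi_pos
  have e : 1 / 2 + (Real.sqrt (2 * Real.pi))⁻¹ * (Real.sqrt (2 * Real.pi) / 2) = 1 := by
    field_simp
    norm_num
  rw [e] at h2
  exact h2

lemma Vfun_symm (x y : ℝ) : Vfun x y = Vfun y x := by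
  by_cases h : x = y
  · rw [h]
  · have h' : ¬ y = x := fun e => h e.symm
    simp only [Vfun, h, h', if_false, max_comm x y, min_comm x y, abs_sub_comm y x, add_comm x y]

lemma V_zero (y : ℝ) (hy : 0 < y) :
    Tendsto (fun x => Vfun x y) (nhdsWithin 0 (Set.Ioi 0)) (nhds 0) := by
  have hs : Real.sqrt y ≠ 0 := (Real.sqrt_pos.mpr hy).ne'
  have key : ContinuousAt (fun x => Phi (y / Real.sqrt (y - x))
      - Real.exp (-2 * x) * Phi ((y - x - x) / Real.sqrt (y - x))
      - Real.exp (-(x + y) / 2) * (2 * Phi (x / Real.sqrt (y - x)) - 1)) 0 := by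
    have hs0 : Real.sqrt (y - 0) ≠ 0 := by simpa using hs
    have c0 : ContinuousAt (fun x : ℝ => Real.sqrt (y - x)) 0 := by fun_prop
    have c1 : ContinuousAt (fun x : ℝ => Phi (y / Real.sqrt (y - x))) 0 :=
      Phi_cont.continuousAt.comp (continuousAt_const.div c0 hs0)
    have c2 : ContinuousAt (fun x : ℝ => Phi ((y - x - x) / Real.sqrt (y - x))) 0 :=
      Phi_cont.continuousAt.comp
        (ContinuousAt.div (f := fun x : ℝ => y - x - x) (by fun_prop) c0 hs0)
    have c3 : ContinuousAt (fun x : ℝ => Phi (x / Real.sqrt (y - x))) 0 :=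
      Phi_cont.continuousAt.comp (continuousAt_id.div c0 hs0)
    fun_prop
  have k := key.tendsto
  simp only [sub_zero, mul_zero, Real.exp_zero, one_mul, zero_div, Phi_zero, sub_self] at k
  norm_num at k
  refine (k.mono_left nhdsWithin_le_nhds).congr' ?_
  filter_upwards [Ioo_mem_nhdsGT hy] with x hx
  have h : ¬ x = y := hx.2.ne
  simp only [Vfun, h, if_false, max_eq_right hx.2.le, min_eq_left hx.2.le,
    abs_of_pos (sub_pos.mpr hx.2)]
  ring_nf

lemma V_top (y : ℝ) (hy : 0 < y) :
    Tendsto (fun x => Vfun x y) atTop (nhds (1 - Real.exp (-2 * y))) := by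
  have s : Tendsto (fun x : ℝ => Real.sqrt (x - y)) atTop atTop :=
    Real.tendsto_sqrt_atTop.comp (tendsto_atTop_add_const_right _ (-y) tendsto_id)
  have d : Tendsto (fun x : ℝ => y / Real.sqrt (x - y)) atTop (nhds 0) :=
    s.const_div_atTop y
  have t1 := Phi_top.comp (s.atTop_add d)
  have t2 := Phi_top.comp (s.atTop_add d.neg)
  have t3 := (Phi_cont.tendsto 0).comp d
  have t4 : Tendsto (fun x : ℝ => Real.exp (-(x + y) / 2)) atTop (nhds 0) := by
    have : Tendsto (fun x : ℝ => (x + y) / 2) atTop atTop :=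
      (tendsto_atTop_add_const_right _ y tendsto_id).atTop_div_const (by norm_num)
    have h := Real.tendsto_exp_neg_atTop_nhds_zero.comp this
    refine h.congr fun x => ?_
    simp only [Function.comp]
    congr 1
    ring
  have t := (t1.sub (t2.const_mul (Real.exp (-2 * y)))).sub
    (t4.mul ((t3.const_mul 2).sub_const 1))
  rw [zero_mul, sub_zero, mul_one] at t
  refine t.congr' ?_
  filter_upwards [eventually_gt_atTop y] with x hx
  have h : ¬ x = y := hx.ne'
  have hp : 0 < x - y := sub_pos.mpr hx
  have hs : 0 < Real.sqrt (x - y) := Real.sqrt_pos.mpr hp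
  have hq : Real.sqrt (x - y) ^ 2 = x - y := Real.sq_sqrt hp.le
  have e1 : Real.sqrt (x - y) + y / Real.sqrt (x - y) = x / Real.sqrt (x - y) := by
    field_simp
    linarith
  have e2 : Real.sqrt (x - y) + -(y / Real.sqrt (x - y)) = (x - y - y) / Real.sqrt (x - y) := by
    field_simp
    linarith
  simp only [Vfun, h, if_false, max_eq_left hx.le, min_eq_right hx.le, abs_sub_comm y x,
    abs_of_pos hp, Function.comp, e1, e2]

theorem stmt9 :
    (∀ y : ℝ, 0 < y →
        Tendsto (fun x => Vfun x y) (nhdsWithin 0 (Set.Ioi 0)) (nhds 0)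
        ∧ Tendsto (fun x => Vfun x y) atTop (nhds (1 - Real.exp (-2 * y))))
    ∧ (∀ x : ℝ, 0 < x →
        Tendsto (fun y => Vfun x y) (nhdsWithin 0 (Set.Ioi 0)) (nhds 0)
        ∧ Tendsto (fun y => Vfun x y) atTop (nhds (1 - Real.exp (-2 * x)))) := by
  refine ⟨fun y hy => ⟨V_zero y hy, V_top y hy⟩, fun x hx => ?_⟩
  simp only [Vfun_symm x]
  exact ⟨V_zero x hx, V_top x hx⟩
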